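/- Let F = x_0x_1^{a_1}⋯x_n^{a_n} + y_0^{b_0}y_1^{b_1}⋯y_m^{b_m} ∈ ℂ[x_0,…,x_n,y_0,…,y_m], where all exponents are at least 1, b_0 ≤ b_i for all i = 1,…,m, and the common degree d ≥ 3. Then the Waring locus of F is contained in V(X_0Y_0): every nonzero linear form L appearing in a minimal Waring decomposition of F has either zero coefficient on x_0 or zero coefficient on y_0. -/

import Mathlib

open MvPolynomial

noncomputable section

/-- The linear form `c₀x₀ + ⋯ + cₙxₙ` with coefficient vector `c`. -/
def lin {σ : Type*} [Fintype σ] (c : σ → ℂ) : MvPolynomial σ ℂ :=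
  ∑ i, C (c i) * X i

/-- `F` admits a Waring decomposition `F = L₁^d + ⋯ + L_r^d`. -/
def HasWaringDecomp {σ : Type*} [Fintype σ] (d : ℕ) (F : MvPolynomial σ ℂ) (r : ℕ) : Prop :=
  ∃ L : Fin r → σ → ℂ, F = ∑ j, lin (L j) ^ d

/-- The Waring rank of `F` (as a form of degree `d`). -/
def waringRank {σ : Type*} [Fintype σ] (d : ℕ) (F : MvPolynomial σ ℂ) : ℕ :=
  sInf {r | HasWaringDecomp d F r}

/-- The linear form with coefficient vector `a` lies in the Waring locus of `F`:
there are linear forms `L₂, …, L_r` with `r = rk F` such that `F` lies in the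
`ℂ`-linear span of `L^d, L₂^d, …, L_r^d`. -/
def InWaringLocus {σ : Type*} [Fintype σ] (d : ℕ) (F : MvPolynomial σ ℂ) (a : σ → ℂ) : Prop :=
  ∃ (c : Fin (waringRank d F) → ℂ) (L : Fin (waringRank d F) → σ → ℂ)
    (j₀ : Fin (waringRank d F)), L j₀ = a ∧ F = ∑ j, c j • lin (L j) ^ d


lemma coeff_lin_pow {σ : Type*} [Fintype σ] [DecidableEq σ] (c : σ → ℂ) (d : ℕ) (e : σ →₀ ℕ)
    (he : e.degree = d) :
    coeff e (lin c ^ d) = (Nat.multinomial Finset.univ e : ℂ) * ∏ i, c i ^ e i := by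
  unfold lin
  rw [Finset.sum_pow_eq_sum_piAntidiag, coeff_sum, Finset.sum_eq_single (e : σ → ℕ)]
  · have : (∏ i, (C (c i) * X i : MvPolynomial σ ℂ) ^ e i) = monomial e (∏ i, c i ^ e i) := by
      rw [monomial_eq, Finsupp.prod_fintype _ _ (by simp), map_prod, ← Finset.prod_mul_distrib]
      simp [mul_pow]
    rw [this, ← map_natCast (C : ℂ →+* MvPolynomial σ ℂ), coeff_C_mul, coeff_monomial, if_pos rfl]
  · intro k _ hk
    have : (∏ i, (C (c i) * X i : MvPolynomial σ ℂ) ^ k i)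
        = monomial (Finsupp.equivFunOnFinite.symm k) (∏ i, c i ^ k i) := by
      rw [monomial_eq, Finsupp.prod_fintype _ _ (by simp), map_prod, ← Finset.prod_mul_distrib]
      simp [mul_pow]
    rw [this, ← map_natCast (C : ℂ →+* MvPolynomial σ ℂ), coeff_C_mul, coeff_monomial, if_neg,
      mul_zero]
    rintro rfl
    exact hk (by ext; simp)
  · intro h
    exact absurd (by simp [Finset.mem_piAntidiag, ← he, Finsupp.degree_eq_sum]) h

lemma lin_isHomogeneous {σ : Type*} [Fintype σ] (c : σ → ℂ) : (lin c).IsHomogeneous 1 := by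
  unfold lin
  exact IsHomogeneous.sum _ _ _ fun i _ => isHomogeneous_C_mul_X _ _

lemma hasWaringDecomp_of_coeffs {σ ι : Type*} [Fintype σ] [Fintype ι] {d : ℕ} (hd : 0 < d)
    {F : MvPolynomial σ ℂ} (c : ι → ℂ) (L : ι → σ → ℂ) (h : F = ∑ j, C (c j) * lin (L j) ^ d) :
    HasWaringDecomp d F (Fintype.card ι) := by
  choose s hs using fun j => IsAlgClosed.exists_pow_nat_eq (c j) hd
  let e := (Fintype.equivFin ι)
  refine ⟨fun j i => s (e.symm j) * L (e.symm j) i, ?_⟩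
  rw [h, ← e.symm.sum_comp]
  refine Finset.sum_congr rfl fun j _ => ?_
  rw [← hs, C_pow, ← mul_pow]
  congr 1
  simp [lin, Finset.mul_sum, mul_assoc]

lemma HasWaringDecomp.add {σ : Type*} [Fintype σ] {d r s : ℕ} {F G : MvPolynomial σ ℂ}
    (hF : HasWaringDecomp d F r) (hG : HasWaringDecomp d G s) :
    HasWaringDecomp d (F + G) (r + s) := by
  obtain ⟨L, rfl⟩ := hF
  obtain ⟨M, rfl⟩ := hG
  exact ⟨Fin.append L M, by simp [Fin.sum_univ_add]⟩

lemma HasWaringDecomp.rename {σ τ : Type*} [Fintype σ] [Fintype τ] {d r : ℕ}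
    {F : MvPolynomial σ ℂ} (hF : HasWaringDecomp d F r) (f : σ → τ) :
    HasWaringDecomp d (MvPolynomial.rename f F) r := by
  classical
  obtain ⟨L, rfl⟩ := hF
  refine ⟨fun j t => ∑ i, if f i = t then L j i else 0, ?_⟩
  rw [map_sum]
  refine Finset.sum_congr rfl fun j _ => ?_
  rw [map_pow]
  congr 1
  simp only [lin, map_sum, map_mul, rename_C, rename_X, Finset.sum_mul]
  rw [Finset.sum_comm]
  refine Finset.sum_congr rfl fun i _ => ?_
  rw [Finset.sum_eq_single (f i)] <;> simp +contextual [eq_comm]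

lemma sum_root_pow {N : ℕ} {ζ : ℂ} (hζ : IsPrimitiveRoot ζ N) (k : ℕ) :
    ∑ s : Fin N, (ζ ^ (s : ℕ)) ^ k = if N ∣ k then (N : ℂ) else 0 := by
  have h : ∀ s : Fin N, (ζ ^ (s : ℕ)) ^ k = (ζ ^ k) ^ (s : ℕ) := fun s => by
    rw [← pow_mul, ← pow_mul, mul_comm]
  simp_rw [h]
  rw [Fin.sum_univ_eq_sum_range (fun s => (ζ ^ k) ^ s)]
  split_ifs with hk
  · rw [(hζ.pow_eq_one_iff_dvd k).2 hk]; simp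
  · have h1 : ζ ^ k ≠ 1 := fun h => hk ((hζ.pow_eq_one_iff_dvd k).1 h)
    rw [geom_sum_eq h1, ← pow_mul, mul_comm k, pow_mul, hζ.pow_eq_one, one_pow, sub_self, zero_div]

lemma monomial_decomp (k : ℕ) (a : Fin (k + 1) → ℕ) (hmin : ∀ i, a 0 ≤ a i) (d : ℕ)
    (hd : 0 < d) (hda : ∑ i, a i = d) :
    HasWaringDecomp d (∏ i, X i ^ a i : MvPolynomial (Fin (k + 1)) ℂ)
      (∏ i : Fin k, (a i.succ + 1)) := by
  classical
  have hcard : ∏ i : Fin k, (a i.succ + 1) = Fintype.card ((i : Fin k) → Fin (a i.succ + 1)) := by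
    simp
  rw [hcard]
  let ζ : Fin k → ℂ := fun i => Complex.exp (2 * Real.pi * Complex.I / ((a i.succ + 1 : ℕ) : ℂ))
  have hζ : ∀ i, IsPrimitiveRoot (ζ i) (a i.succ + 1) := fun i =>
    Complex.isPrimitiveRoot_exp _ (Nat.succ_ne_zero _)
  let e1 : Fin (k + 1) →₀ ℕ := Finsupp.equivFunOnFinite.symm a
  have he1 : (∏ i, X i ^ a i : MvPolynomial (Fin (k + 1)) ℂ) = monomial e1 1 := by
    rw [monomial_eq, Finsupp.prod_fintype _ _ (by simp)]
    simp [e1]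
  have hdeg1 : e1.degree = d := by simp [Finsupp.degree_eq_sum, e1, hda]
  let K : ℂ := (Nat.multinomial Finset.univ e1 : ℂ) * ∏ i : Fin k, ((a i.succ + 1 : ℕ) : ℂ)
  have hK : K ≠ 0 := by
    refine mul_ne_zero (Nat.cast_ne_zero.2 (Nat.multinomial_pos _ _).ne') ?_
    exact Finset.prod_ne_zero_iff.2 fun i _ => Nat.cast_ne_zero.2 (Nat.succ_ne_zero _)
  refine hasWaringDecomp_of_coeffs hd
    (fun s => K⁻¹ * ∏ i, ζ i ^ (s i : ℕ)) (fun s => Fin.cons 1 (fun i => ζ i ^ (s i : ℕ))) ?_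
  rw [he1]
  ext e
  rw [coeff_sum, coeff_monomial]
  simp only [coeff_C_mul]
  by_cases he : e.degree = d
  · simp only [coeff_lin_pow _ _ _ he, Fin.prod_univ_succ, Fin.cons_zero, Fin.cons_succ, one_pow,
      one_mul]
    have h1 : ∀ s : (i : Fin k) → Fin (a i.succ + 1),
        K⁻¹ * (∏ i, ζ i ^ (s i : ℕ)) * ((Nat.multinomial Finset.univ e : ℂ) *
          ∏ i : Fin k, (ζ i ^ (s i : ℕ)) ^ e i.succ)
        = K⁻¹ * (Nat.multinomial Finset.univ e : ℂ) *
          ∏ i : Fin k, (ζ i ^ (s i : ℕ)) ^ (e i.succ + 1) := fun s => by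
      simp only [pow_succ _ (e _), Finset.prod_mul_distrib]
      ring
    simp only [h1]
    rw [← Finset.mul_sum, ← Fintype.prod_sum (fun (i : Fin k) (s : Fin (a i.succ + 1)) => (ζ i ^ (s : ℕ)) ^ (e i.succ + 1))]
    simp only [sum_root_pow (hζ _)]
    split_ifs with h
    · subst h
      simp only [e1, Finsupp.equivFunOnFinite_symm_apply_apply, dvd_refl, if_true]
      rw [mul_assoc]
      exact (inv_mul_cancel₀ hK).symm
    · rw [eq_comm, mul_eq_zero]
      right
      by_contra hne
      rw [← ne_eq, Finset.prod_ne_zero_iff] at hne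
      have hdvd : ∀ i : Fin k, a i.succ + 1 ∣ e i.succ + 1 := fun i => by
        by_contra hn
        exact hne i (Finset.mem_univ _) (if_neg hn)
      apply h
      have hsum : e 0 + ∑ i : Fin k, e i.succ = a 0 + ∑ i : Fin k, a i.succ := by
        rw [← Fin.sum_univ_succ, ← Fin.sum_univ_succ, hda, ← he, Finsupp.degree_eq_sum]
      have hge : ∀ i : Fin k, a i.succ ≤ e i.succ := fun i => by
        have := Nat.le_of_dvd (Nat.succ_pos _) (hdvd i)
        omega
      have heq : ∀ i : Fin k, e i.succ = a i.succ := fun i => by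
        by_contra hne
        obtain ⟨q, hq⟩ := hdvd i
        have hq2 : 2 ≤ q := by
          rcases q with _ | _ | q
          · omega
          · omega
          · omega
        have h3 : e i.succ ≥ a i.succ + (a i.succ + 1) := by nlinarith
        have h4 := hmin i.succ
        have h5 : ∑ i : Fin k, a i.succ + (a i.succ + 1) ≤ ∑ i : Fin k, e i.succ := by
          rw [← Finset.add_sum_erase _ _ (Finset.mem_univ i),
            ← Finset.add_sum_erase _ (fun i : Fin k => e i.succ) (Finset.mem_univ i)]
          have := Finset.sum_le_sum (fun j (_ : j ∈ Finset.univ.erase i) => hge j)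
          omega
        omega
      ext i
      refine Fin.cases ?_ (fun i => ?_) i
      · simp only [heq] at hsum
        simpa [e1] using (Nat.add_right_cancel hsum).symm
      · simpa [e1] using (heq i).symm
  · rw [if_neg (by rintro rfl; exact he hdeg1), eq_comm]
    refine Finset.sum_eq_zero fun s _ => ?_
    have := (lin_isHomogeneous (Fin.cons 1 (fun i => ζ i ^ (s i : ℕ)) : Fin (k+1) → ℂ)).pow d
    rw [this.coeff_eq_zero (by rwa [one_mul]), mul_zero]

lemma waringRank_le (n m : ℕ)
    (a : Fin (n + 1) → ℕ) (b : Fin (m + 1) → ℕ)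
    (hamin : ∀ i, a 0 ≤ a i) (hbmin : ∀ j, b 0 ≤ b j)
    (d : ℕ) (hda : ∑ i, a i = d) (hdb : ∑ j, b j = d) (hd : 0 < d) :
    waringRank d ((∏ i, X (Sum.inl i) ^ a i) + ∏ j, X (Sum.inr j) ^ b j :
            MvPolynomial (Fin (n + 1) ⊕ Fin (m + 1)) ℂ) ≤
      (∏ i : Fin n, (a i.succ + 1)) + ∏ j : Fin m, (b j.succ + 1) := by
  apply Nat.sInf_le
  have h1 := (monomial_decomp n a hamin d hd hda).rename (Sum.inl : _ → Fin (n + 1) ⊕ Fin (m + 1))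
  have h2 := (monomial_decomp m b hbmin d hd hdb).rename (Sum.inr : _ → Fin (n + 1) ⊕ Fin (m + 1))
  simpa using h1.add h2

/-- The linear-algebra data extracted from a decomposition of `x^{e1} + x^{e2}`: a weighted set of
points computing the apolarity pairing with the form. -/
structure Ap {σ : Type*} [Fintype σ] [DecidableEq σ] (d r : ℕ) (e1 e2 : σ →₀ ℕ) (x0 y0 : σ)
    (c : Fin r → ℂ) (p : Fin r → σ → ℂ) (l1 l2 : ℂ) : Prop where
  deg1 : e1.degree = d
  deg2 : e2.degree = d
  disj : ∀ i, e1 i = 0 ∨ e2 i = 0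
  pos1 : e1 x0 ≠ 0
  pos2 : e2 y0 ≠ 0
  hl1 : l1 ≠ 0
  hl2 : l2 ≠ 0
  pairing : ∀ G : MvPolynomial σ ℂ, G.IsHomogeneous d →
    ∑ j, c j * eval (p j) G = coeff e1 G * l1 + coeff e2 G * l2

namespace Ap

variable {σ : Type*} [Fintype σ] [DecidableEq σ] {d r : ℕ} {e1 e2 : σ →₀ ℕ} {x0 y0 : σ}
    {c : Fin r → ℂ} {p : Fin r → σ → ℂ} {l1 l2 : ℂ}

lemma swap (h : Ap d r e1 e2 x0 y0 c p l1 l2) : Ap d r e2 e1 y0 x0 c p l2 l1 where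
  deg1 := h.deg2
  deg2 := h.deg1
  disj i := (h.disj i).symm
  pos1 := h.pos2
  pos2 := h.pos1
  hl1 := h.hl2
  hl2 := h.hl1
  pairing G hG := by rw [h.pairing G hG, add_comm]

lemma coeff_zero (h : Ap d r e1 e2 x0 y0 c p l1 l2) {G : MvPolynomial σ ℂ} {e : σ →₀ ℕ}
    (hG : G.IsHomogeneous e.degree) (he : e ≤ e1) {i : σ} (hi : e i < e1 i)
    (hv : ∀ j, eval (p j) G = 0 ∨ (p j x0 = 0 ∧ e x0 < e1 x0)) : coeff e G = 0 := by
  have hH : (monomial (e1 - e) (1 : ℂ) * G).IsHomogeneous d := by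
    have := (isHomogeneous_monomial (1 : ℂ) (rfl : (e1 - e).degree = _)).mul hG
    rwa [← map_add, tsub_add_cancel_of_le he, h.deg1] at this
  have h1 := h.pairing _ hH
  rw [Finset.sum_eq_zero, coeff_monomial_mul', coeff_monomial_mul', if_pos tsub_le_self,
    if_neg, tsub_tsub_cancel_of_le he] at h1
  · simpa [h.hl1] using h1.symm
  · intro hle
    have h2 := hle i
    rw [Finsupp.tsub_apply] at h2
    rcases h.disj i with h3 | h3 <;> omega
  · intro j _
    rcases hv j with hj | ⟨hj, hlt⟩
    · simp [hj]
    · have : eval (p j) (monomial (e1 - e) (1 : ℂ)) = 0 := by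
        rw [eval_monomial, one_mul, Finsupp.prod_fintype _ _ (by simp)]
        refine Finset.prod_eq_zero (Finset.mem_univ x0) ?_
        rw [hj, Finsupp.tsub_apply, zero_pow (by omega)]
      simp [this]

lemma x0y0 (h : Ap d r e1 e2 x0 y0 c p l1 l2) : e1 y0 = 0 ∧ e2 x0 = 0 := by
  have := h.disj x0
  have := h.disj y0
  have := h.pos1
  have := h.pos2
  tauto

lemma ne (h : Ap d r e1 e2 x0 y0 c p l1 l2) : x0 ≠ y0 := by
  rintro rfl
  exact h.pos1 h.x0y0.1

end Ap

section aux

variable {σ : Type*} [Fintype σ] [DecidableEq σ]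

lemma eval_lin (z q : σ → ℂ) : eval q (lin z) = ∑ i, z i * q i := by
  simp [lin]

lemma coeff_single_lin (z : σ → ℂ) (i : σ) : coeff (Finsupp.single i 1) (lin z) = z i := by
  rw [lin, coeff_sum, Finset.sum_eq_single i]
  · simp [coeff_C_mul]
  · intro k _ hk
    rw [coeff_C_mul, coeff_X, if_neg, mul_zero]
    intro h
    exact hk (Finsupp.single_left_injective one_ne_zero h)
  · simp

lemma hom_one_eq_lin {G : MvPolynomial σ ℂ} (hG : G.IsHomogeneous 1) :
    G = lin (fun i => coeff (Finsupp.single i 1) G) := by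
  ext e
  by_cases he : e.degree = 1
  · obtain ⟨i, rfl⟩ : ∃ i, e = Finsupp.single i 1 := by
      obtain ⟨i, hi⟩ : ∃ i, e i ≠ 0 := by
        by_contra! hcon
        rw [Finsupp.degree_eq_sum, Finset.sum_eq_zero fun i _ => hcon i] at he
        omega
      have hle : Finsupp.single i 1 ≤ e := by
        rw [Finsupp.single_le_iff]
        omega
      refine ⟨i, ?_⟩
      have h2 := congrArg Finsupp.degree (tsub_add_cancel_of_le hle)
      rw [map_add, Finsupp.degree_single, he] at h2
      have h3 := (Finsupp.degree_eq_zero_iff (e - Finsupp.single i 1)).1 (by omega)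
      rw [← tsub_add_cancel_of_le hle, h3, zero_add]
    rw [coeff_single_lin]
  · rw [hG.coeff_eq_zero he, (lin_isHomogeneous _).coeff_eq_zero he]

lemma coeff_X_mul_zero {e : σ →₀ ℕ} {s : σ} (h : e s = 0) (Q : MvPolynomial σ ℂ) :
    coeff e (X s * Q) = 0 := by
  rw [coeff_X_mul', if_neg (by simp [h])]

/-- The auxiliary linear form `x0 + γ y0`. -/
def tf (x0 y0 : σ) (γ : ℂ) : MvPolynomial σ ℂ := X x0 + C γ * X y0

lemma tf_hom (x0 y0 : σ) (γ : ℂ) : (tf x0 y0 γ).IsHomogeneous 1 :=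
  (isHomogeneous_X _ _).add (isHomogeneous_C_mul_X _ _)

lemma eval_tf (x0 y0 : σ) (γ : ℂ) (q : σ → ℂ) : eval q (tf x0 y0 γ) = q x0 + γ * q y0 := by
  simp [tf]

lemma coeff_tf_mul_zero {e : σ →₀ ℕ} {x0 y0 : σ} (γ : ℂ) (hx : e x0 = 0) (hy : e y0 = 0)
    (Q : MvPolynomial σ ℂ) : coeff e (tf x0 y0 γ * Q) = 0 := by
  rw [tf, add_mul, coeff_add, coeff_X_mul_zero hx, mul_assoc, coeff_C_mul, coeff_X_mul_zero hy]
  simp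

/-- The exponents used in the lower bound. -/
def UU (e1 e2 : σ →₀ ℕ) (x0 y0 : σ) : Finset (σ →₀ ℕ) :=
  Finset.Iic (e1.erase x0) ∪ Finset.Iic (e2.erase y0)

end aux

namespace Ap

variable {σ : Type*} [Fintype σ] [DecidableEq σ] {d r : ℕ} {e1 e2 : σ →₀ ℕ} {x0 y0 : σ}
    {c : Fin r → ℂ} {p : Fin r → σ → ℂ} {l1 l2 : ℂ}

lemma card_UU (h : Ap d r e1 e2 x0 y0 c p l1 l2) : (UU e1 e2 x0 y0).card + 1 =
    (Finset.Iic (e1.erase x0)).card + (Finset.Iic (e2.erase y0)).card := by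
  rw [← Finset.card_union_add_card_inter, UU]
  congr 1
  symm
  rw [Finset.card_eq_one]
  refine ⟨0, ?_⟩
  ext u
  simp only [Finset.mem_inter, Finset.mem_Iic, Finset.mem_singleton]
  constructor
  · rintro ⟨h1, h2⟩
    ext i
    have h1 := h1 i
    have h2 := h2 i
    rw [Finsupp.erase_apply] at h1 h2
    have := h.disj i
    simp only [Finsupp.coe_zero, Pi.zero_apply]
    split_ifs at h1 h2 <;> omega
  · rintro rfl
    simp

lemma mem_left (h : Ap d r e1 e2 x0 y0 c p l1 l2) {u : σ →₀ ℕ} (hu : u ≤ e1.erase x0) :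
    u ≤ e1 ∧ u x0 = 0 ∧ u y0 = 0 ∧ u x0 < e1 x0 := by
  have h1 : u x0 = 0 := by simpa using hu x0
  have h2 : u y0 ≤ (e1.erase x0) y0 := hu y0
  have h3 := h.pos1
  rw [Finsupp.erase_ne h.ne.symm, h.x0y0.1] at h2
  refine ⟨fun i => ?_, h1, by omega, by omega⟩
  have := hu i
  rw [Finsupp.erase_apply] at this
  split_ifs at this <;> omega

lemma mem_UU (h : Ap d r e1 e2 x0 y0 c p l1 l2) {u : σ →₀ ℕ} (hu : u ∈ UU e1 e2 x0 y0) :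
    u x0 = 0 ∧ u y0 = 0 ∧ u.degree < d := by
  have key : ∀ {f : σ →₀ ℕ} {i}, f.degree = d → u ≤ f → u i < f i → u.degree < d := by
    intro f i hf hle hlt
    rw [← hf, Finsupp.degree_eq_sum, Finsupp.degree_eq_sum]
    exact Finset.sum_lt_sum (fun i _ => hle i) ⟨i, Finset.mem_univ _, hlt⟩
  rcases Finset.mem_union.1 hu with hu | hu
  · obtain ⟨a1, a2, a3, a4⟩ := h.mem_left (Finset.mem_Iic.1 hu)
    exact ⟨a2, a3, key h.deg1 a1 a4⟩
  · obtain ⟨a1, a2, a3, a4⟩ := h.swap.mem_left (Finset.mem_Iic.1 hu)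
    exact ⟨a3, a2, key h.deg2 a1 a4⟩

lemma coeff_zero_UU (h : Ap d r e1 e2 x0 y0 c p l1 l2) {u : σ →₀ ℕ} (hu : u ∈ UU e1 e2 x0 y0)
    {G : MvPolynomial σ ℂ} (hG : G.IsHomogeneous u.degree)
    (hv : ∀ j, (p j x0 ≠ 0 ∨ p j y0 ≠ 0) → eval (p j) G = 0) : coeff u G = 0 := by
  rcases Finset.mem_union.1 hu with hu | hu
  · obtain ⟨a1, a2, a3, a4⟩ := h.mem_left (Finset.mem_Iic.1 hu)
    refine h.coeff_zero hG a1 a4 fun j => ?_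
    have := hv j
    tauto
  · obtain ⟨a1, a2, a3, a4⟩ := h.swap.mem_left (Finset.mem_Iic.1 hu)
    refine h.swap.coeff_zero hG a1 a4 fun j => ?_
    have := hv j
    tauto

lemma sum_hom {k : ℕ} {γ : ℂ} (g : UU e1 e2 x0 y0 → ℂ)
    (hg : ∀ u, k < u.1.degree → g u = 0) :
    (∑ u, C (g u) * (monomial u.1 1 * tf x0 y0 γ ^ (k - u.1.degree))).IsHomogeneous k := by
  refine IsHomogeneous.sum _ _ _ fun u _ => ?_
  by_cases hu : k < u.1.degree
  · rw [hg u hu, C_0, zero_mul]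
    exact isHomogeneous_zero _ _ _
  · refine IsHomogeneous.C_mul ?_ _
    have := (isHomogeneous_monomial (1 : ℂ) (rfl : u.1.degree = _)).mul
      ((tf_hom x0 y0 γ).pow (k - u.1.degree))
    convert this using 1
    omega

lemma top (h : Ap d r e1 e2 x0 y0 c p l1 l2) {γ : ℂ} {k : ℕ} (g : UU e1 e2 x0 y0 → ℂ)
    (hg : ∀ u, k < u.1.degree → g u = 0) (Q : MvPolynomial σ ℂ) (hQ : (X x0 * Q).IsHomogeneous k)
    (hv : ∀ j, (p j x0 ≠ 0 ∨ p j y0 ≠ 0) → eval (p j)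
      (X x0 * Q + ∑ u, C (g u) * (monomial u.1 1 * tf x0 y0 γ ^ (k - u.1.degree))) = 0)
    (u0 : UU e1 e2 x0 y0) (hu0 : u0.1.degree = k) : g u0 = 0 := by
  have hx := h.mem_UU u0.2
  have h1 := h.coeff_zero_UU u0.2 (by rw [hu0]; exact hQ.add (sum_hom g hg)) hv
  rw [coeff_add, coeff_X_mul_zero hx.1, zero_add, coeff_sum, Finset.sum_eq_single u0] at h1
  · simpa [hu0, coeff_C_mul] using h1
  · intro u _ hu
    rw [coeff_C_mul]
    rcases lt_trichotomy u.1.degree k with hlt | heq | hgt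
    · obtain ⟨q, hq⟩ : ∃ q, k - u.1.degree = q + 1 := ⟨k - u.1.degree - 1, by omega⟩
      rw [hq, pow_succ', mul_left_comm, coeff_tf_mul_zero _ hx.1 hx.2.1, mul_zero]
    · rw [heq, Nat.sub_self, pow_zero, mul_one, coeff_monomial, if_neg, mul_zero]
      intro h
      exact hu (Subtype.ext h)
    · rw [hg u hgt, zero_mul]
  · simp

lemma exists_mult (h : Ap d r e1 e2 x0 y0 c p l1 l2) (hd : 3 ≤ d) {γ : ℂ} (hγ : γ ≠ 0)
    (ht : ∀ j, (p j x0 ≠ 0 ∨ p j y0 ≠ 0) → p j x0 + γ * p j y0 ≠ 0)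
    (hr : r ≤ (Finset.Iic (e1.erase x0)).card + (Finset.Iic (e2.erase y0)).card)
    (z : σ → ℂ) : ∃ z' : σ → ℂ, ∀ j,
      p j x0 * eval (p j) (lin z) = (p j x0 + γ * p j y0) * eval (p j) (lin z') := by
  let v : Option (Option (UU e1 e2 x0 y0)) → Fin r → ℂ := fun o j =>
    match o with
    | none => p j x0 * eval (p j) (lin z) * (p j x0 + γ * p j y0) ^ (d - 2)
    | some none => p j x0 * (p j x0 + γ * p j y0) ^ (d - 1)
    | some (some u) => eval (p j) (monomial u.1 1) * (p j x0 + γ * p j y0) ^ (d - u.1.degree)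
  have hdep : ¬ LinearIndependent ℂ v := by
    intro hli
    have h1 := hli.fintype_card_le_finrank
    have h2 := h.card_UU
    simp only [Fintype.card_option, Fintype.card_coe, Module.finrank_fintype_fun_eq_card,
      Fintype.card_fin] at h1
    omega
  obtain ⟨g, hg, o, ho⟩ := Fintype.not_linearIndependent_iff.1 hdep
  set β := g none with hβ
  set α := g (some none) with hα
  set f : UU e1 e2 x0 y0 → ℂ := fun u => g (some (some u)) with hf
  have hrel : ∀ j, β * (p j x0 * eval (p j) (lin z) * (p j x0 + γ * p j y0) ^ (d - 2)) +
      (α * (p j x0 * (p j x0 + γ * p j y0) ^ (d - 1)) + ∑ u, f u *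
        (eval (p j) (monomial u.1 1) * (p j x0 + γ * p j y0) ^ (d - u.1.degree))) = 0 := by
    intro j
    have := congrFun hg j
    simpa [Fintype.sum_option, v, Finset.sum_apply] using this
  -- pulling out a power of `t` from the sum
  have hpull : ∀ j k, k ≤ d → (∀ u, k < u.1.degree → f u = 0) →
      ∑ u, f u * (eval (p j) (monomial u.1 1) * (p j x0 + γ * p j y0) ^ (d - u.1.degree)) =
      (p j x0 + γ * p j y0) ^ (d - k) * eval (p j)
        (∑ u, C (f u) * (monomial u.1 1 * tf x0 y0 γ ^ (k - u.1.degree))) := by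
    intro j k hk hz
    rw [map_sum, Finset.mul_sum]
    refine Finset.sum_congr rfl fun u _ => ?_
    by_cases hu : k < u.1.degree
    · simp [hz u hu]
    · have : d - u.1.degree = (d - k) + (k - u.1.degree) := by omega
      rw [this, pow_add, map_mul, map_mul, map_pow, eval_tf, eval_C]
      ring
  have hbig : ∀ u, 1 < u.1.degree → f u = 0 := by
    by_contra! hcon
    obtain ⟨w, hw1, hw2⟩ := hcon
    obtain ⟨u0, hu0, hmax⟩ := Finset.exists_max_image
      (Finset.univ.filter fun u : UU e1 e2 x0 y0 => 1 < u.1.degree ∧ f u ≠ 0)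
      (fun u => u.1.degree) ⟨w, by simp [hw1, hw2]⟩
    simp only [Finset.mem_filter, Finset.mem_univ, true_and] at hu0 hmax
    have hz : ∀ u, u0.1.degree < u.1.degree → f u = 0 := by
      intro u hu
      by_contra hne
      have := hmax u ⟨by omega, hne⟩
      omega
    have hkd := (h.mem_UU u0.2).2.2
    obtain ⟨k, hk⟩ : ∃ k, u0.1.degree = k + 2 := ⟨u0.1.degree - 2, by omega⟩
    refine hu0.2 (h.top (γ := γ) (k := k + 2) f (by rwa [← hk])
      (C β * (lin z * tf x0 y0 γ ^ k) + C α * tf x0 y0 γ ^ (k + 1)) ?_ ?_ u0 hk)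
    · have h1 : (C β * (lin z * tf x0 y0 γ ^ k)).IsHomogeneous (k + 1) := by
        refine IsHomogeneous.C_mul ?_ _
        have := (lin_isHomogeneous z).mul ((tf_hom x0 y0 γ).pow k)
        convert this using 1
        omega
      have h2 : (C α * tf x0 y0 γ ^ (k + 1)).IsHomogeneous (k + 1) := by
        refine IsHomogeneous.C_mul ?_ _
        have := ((tf_hom x0 y0 γ).pow (k + 1))
        convert this using 1
        omega
      have := (isHomogeneous_X ℂ x0).mul (h1.add h2)
      convert this using 1
      omega
    · intro j hj
      have h3 := hrel j
      rw [hpull j (k + 2) (by omega) (by rwa [← hk])] at h3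
      have h4 : d - 2 = (d - (k + 2)) + k := by omega
      have h5 : d - 1 = (d - (k + 2)) + (k + 1) := by omega
      rw [h4, h5, pow_add, pow_add] at h3
      refine (mul_eq_zero.1 ?_).resolve_left (pow_ne_zero (d - (k + 2)) (ht j hj))
      rw [← h3]
      simp only [map_add, map_mul, map_pow, eval_C, eval_X, eval_tf]
      ring
  have hℓ : (C α * X x0 + ∑ u, C (f u) * (monomial u.1 1 * tf x0 y0 γ ^ (1 - u.1.degree))
      ).IsHomogeneous 1 := (isHomogeneous_C_mul_X _ _).add (sum_hom f hbig)
  set ℓ := C α * X x0 + ∑ u, C (f u) * (monomial u.1 1 * tf x0 y0 γ ^ (1 - u.1.degree)) with hℓdef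
  have hrel2 : ∀ j, (p j x0 ≠ 0 ∨ p j y0 ≠ 0) → β * (p j x0 * eval (p j) (lin z)) +
      (p j x0 + γ * p j y0) * eval (p j) ℓ = 0 := by
    intro j hj
    have h3 := hrel j
    rw [hpull j 1 (by omega) hbig] at h3
    have h5 : d - 1 = (d - 2) + 1 := by omega
    rw [h5, pow_add] at h3
    refine (mul_eq_zero.1 ?_).resolve_left (pow_ne_zero (d - 2) (ht j hj))
    rw [← h3, hℓdef]
    simp only [map_add, map_mul, eval_C, eval_X, pow_one]
    ring
  by_cases hβ0 : β = 0
  · exfalso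
    have hℓ0 : ∀ j, (p j x0 ≠ 0 ∨ p j y0 ≠ 0) → eval (p j) ℓ = 0 := by
      intro j hj
      have := hrel2 j hj
      rw [hβ0, zero_mul, zero_add] at this
      exact (mul_eq_zero.1 this).resolve_left (ht j hj)
    have hone : ∀ u : UU e1 e2 x0 y0, u.1.degree = 1 → f u = 0 := by
      intro u hu
      refine h.top (γ := γ) (k := 1) f hbig (C α) ?_ ?_ u hu
      · rw [mul_comm]; exact isHomogeneous_C_mul_X _ _
      · intro j hj
        rw [mul_comm (X x0)]
        exact hℓ0 j hj
    have h0mem : (0 : σ →₀ ℕ) ∈ UU e1 e2 x0 y0 := by simp [UU]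
    have hfz : ∀ u : UU e1 e2 x0 y0, u ≠ ⟨0, h0mem⟩ → f u = 0 := by
      intro u hu
      rcases Nat.lt_trichotomy u.1.degree 1 with h1 | h1 | h1
      · exact absurd (Subtype.ext ((Finsupp.degree_eq_zero_iff _).1 (by omega))) hu
      · exact hone u h1
      · exact hbig u h1
    have hℓ2 : ℓ = C α * X x0 + C (f ⟨0, h0mem⟩) * tf x0 y0 γ := by
      rw [hℓdef, Finset.sum_eq_single ⟨0, h0mem⟩]
      · simp
      · intro u _ hu
        simp [hfz u hu]
      · simp
    have hℓall : ∀ j, eval (p j) ℓ = 0 := by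
      intro j
      by_cases hj : p j x0 ≠ 0 ∨ p j y0 ≠ 0
      · exact hℓ0 j hj
      · push Not at hj
        rw [hℓ2]
        simp [eval_tf, hj]
    have hlt : ∀ {e : σ →₀ ℕ} (s : σ), e.degree = d → ∃ i, (Finsupp.single s 1) i < e i := by
      intro e s he
      by_contra! hcon
      have : e.degree ≤ (Finsupp.single s 1).degree := by
        rw [Finsupp.degree_eq_sum, Finsupp.degree_eq_sum]
        exact Finset.sum_le_sum fun i _ => hcon i
      rw [Finsupp.degree_single] at this
      omega
    have hxy := h.ne
    obtain ⟨i, hi⟩ := hlt x0 h.deg1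
    obtain ⟨i', hi'⟩ := hlt y0 h.deg2
    have e1' := h.coeff_zero (e := Finsupp.single x0 1) (by simpa using hℓ)
      (by simpa using Nat.one_le_iff_ne_zero.2 h.pos1) hi (fun j => Or.inl (hℓall j))
    have e2' := h.swap.coeff_zero (e := Finsupp.single y0 1) (by simpa using hℓ)
      (by simpa using Nat.one_le_iff_ne_zero.2 h.pos2) hi' (fun j => Or.inl (hℓall j))
    have hne1 : (Finsupp.single x0 1 : σ →₀ ℕ) ≠ Finsupp.single y0 1 := fun hh =>
      hxy (Finsupp.single_left_injective one_ne_zero hh)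
    rw [hℓ2] at e1' e2'
    simp only [tf, coeff_add, coeff_C_mul, coeff_X, hne1, hne1.symm, if_true, if_false] at e1' e2'
    have hf0 : f ⟨0, h0mem⟩ = 0 := by simpa [hγ] using e2'
    have hα0 : α = 0 := by simpa [hf0] using e1'
    rcases o with _ | _ | u
    · exact ho hβ0
    · exact ho hα0
    · by_cases hu : u = ⟨0, h0mem⟩
      · exact ho (by rw [hu]; exact hf0)
      · exact ho (hfz u hu)
  · refine ⟨fun i => -β⁻¹ * coeff (Finsupp.single i 1) ℓ, fun j => ?_⟩
    have h6 : eval (p j) (lin fun i => -β⁻¹ * coeff (Finsupp.single i 1) ℓ) =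
        -β⁻¹ * eval (p j) ℓ := by
      conv_rhs => rw [hom_one_eq_lin hℓ]
      simp only [eval_lin, Finset.mul_sum, mul_assoc]
    rw [h6]
    by_cases hj : p j x0 ≠ 0 ∨ p j y0 ≠ 0
    · have := hrel2 j hj
      field_simp
      linear_combination this
    · push Not at hj
      simp [hj]

end Ap

namespace Ap

variable {σ : Type*} [Fintype σ] [DecidableEq σ] {d r : ℕ} {e1 e2 : σ →₀ ℕ} {x0 y0 : σ}
    {c : Fin r → ℂ} {p : Fin r → σ → ℂ} {l1 l2 : ℂ}

lemma exists_lt_two {e : σ →₀ ℕ} (s t : σ) (hd : 3 ≤ e.degree) :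
    ∃ i, (Finsupp.single s 1 + Finsupp.single t 1 : σ →₀ ℕ) i < e i := by
  by_contra! hcon
  have : e.degree ≤ (Finsupp.single s 1 + Finsupp.single t 1 : σ →₀ ℕ).degree := by
    rw [Finsupp.degree_eq_sum, Finsupp.degree_eq_sum]
    exact Finset.sum_le_sum fun i _ => hcon i
  rw [map_add, Finsupp.degree_single, Finsupp.degree_single] at this
  omega

lemma two_le {e : σ →₀ ℕ} {s t : σ} (hs : e s ≠ 0) (ht : e t ≠ 0) (hst : s = t → 2 ≤ e s) :
    (Finsupp.single s 1 + Finsupp.single t 1 : σ →₀ ℕ) ≤ e := by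
  intro i
  simp only [Finsupp.add_apply, Finsupp.single_apply]
  by_cases h1 : s = i
  · subst h1
    by_cases h2 : t = s
    · have := hst h2.symm
      simp [h2]; omega
    · simp [h2]; omega
  · by_cases h2 : t = i
    · subst h2
      simp [h1]; omega
    · simp [h1, h2]

lemma mult_coeffs (h : Ap d r e1 e2 x0 y0 c p l1 l2) (hd : 3 ≤ d) {γ : ℂ} (hγ : γ ≠ 0)
    {z z' : σ → ℂ} (hz : ∀ j,
      p j x0 * eval (p j) (lin z) = (p j x0 + γ * p j y0) * eval (p j) (lin z')) :
    (∀ i, i ≠ x0 → e1 i ≠ 0 → z' i = z i) ∧ (∀ i, e2 i ≠ 0 → (i = y0 → 2 ≤ e2 y0) → z' i = 0) := by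
  set G : MvPolynomial σ ℂ := X x0 * lin z - tf x0 y0 γ * lin z' with hG
  have hGh : G.IsHomogeneous 2 :=
    ((isHomogeneous_X ℂ x0).mul (lin_isHomogeneous z)).sub
      ((tf_hom x0 y0 γ).mul (lin_isHomogeneous z'))
  have hGv : ∀ j, eval (p j) G = 0 := fun j => by
    rw [hG, map_sub, map_mul, map_mul, eval_tf, eval_X, hz j, sub_self]
  have hxy := h.ne
  constructor
  · intro i hi hei
    obtain ⟨k, hk⟩ := exists_lt_two x0 i (h.deg1.symm ▸ hd)
    have hiy : i ≠ y0 := by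
      rintro rfl
      exact hei h.x0y0.1
    have := h.coeff_zero (G := G) (e := Finsupp.single x0 1 + Finsupp.single i 1)
      (by simpa [Finsupp.degree_single] using hGh) (two_le h.pos1 hei (fun hh => absurd hh.symm hi))
      hk (fun j => Or.inl (hGv j))
    rw [hG, tf, coeff_sub, add_mul, coeff_add, coeff_X_mul, coeff_X_mul, coeff_single_lin,
      coeff_single_lin, mul_assoc, coeff_C_mul, coeff_X_mul_zero (by simp [hxy, hiy])] at this
    linear_combination -this
  · intro i hei hi
    obtain ⟨k, hk⟩ := exists_lt_two y0 i (h.deg2.symm ▸ hd)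
    have hix : i ≠ x0 := by
      rintro rfl
      exact hei h.x0y0.2
    have := h.swap.coeff_zero (G := G) (e := Finsupp.single y0 1 + Finsupp.single i 1)
      (by simpa [Finsupp.degree_single] using hGh) (two_le h.pos2 hei (fun hh => hi hh.symm))
      hk (fun j => Or.inl (hGv j))
    rw [hG, tf, coeff_sub, add_mul, coeff_add, mul_assoc, coeff_C_mul, coeff_X_mul,
      coeff_single_lin, coeff_X_mul_zero (by simp [hxy.symm, hix]),
      coeff_X_mul_zero (by simp [hxy.symm, hix])] at this
    simpa [hγ] using this

lemma no_rel (h : Ap d r e1 e2 x0 y0 c p l1 l2) {x1 : σ} (hx1 : x1 ≠ x0) (hx1' : e1 x1 ≠ 0)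
    (A B D : ℂ) (hv : ∀ j, (p j x0 ≠ 0 ∨ p j y0 ≠ 0) →
      A * p j x1 + B * p j x0 + D * p j y0 = 0) : A = 0 := by
  have hx1y : x1 ≠ y0 := by
    rintro rfl
    exact hx1' h.x0y0.1
  have hmem : (Finsupp.single x1 1 : σ →₀ ℕ) ∈ UU e1 e2 x0 y0 := by
    refine Finset.mem_union_left _ (Finset.mem_Iic.2 ?_)
    rw [Finsupp.single_le_iff, Finsupp.erase_ne hx1]
    omega
  have := h.coeff_zero_UU (G := lin (Pi.single x1 A + Pi.single x0 B + Pi.single y0 D)) hmem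
    (by rw [Finsupp.degree_single]; exact lin_isHomogeneous _) (fun j hj => by
      rw [← hv j hj, eval_lin]
      simp [add_mul, Finset.sum_add_distrib, Pi.single_apply])
  rw [coeff_single_lin] at this
  simpa [Pi.single_apply, hx1, hx1y] using this

lemma final (h : Ap d r e1 e2 x0 y0 c p l1 l2) (hd : 3 ≤ d) (hx0 : e1 x0 = 1)
    (hall : ∀ i, e1 i ≠ 0 ∨ e2 i ≠ 0)
    (hr : r ≤ (Finset.Iic (e1.erase x0)).card + (Finset.Iic (e2.erase y0)).card) (j₀ : Fin r) :
    p j₀ x0 = 0 ∨ p j₀ y0 = 0 := by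
  obtain ⟨γ, hγS⟩ := Infinite.exists_notMem_finset
    (insert 0 (Finset.univ.image fun j => - p j x0 / p j y0) : Finset ℂ)
  simp only [Finset.mem_insert, Finset.mem_image, Finset.mem_univ, true_and, not_or,
    not_exists] at hγS
  obtain ⟨hγ, hγ2⟩ := hγS
  have ht : ∀ j, (p j x0 ≠ 0 ∨ p j y0 ≠ 0) → p j x0 + γ * p j y0 ≠ 0 := by
    intro j hj h0
    by_cases hy : p j y0 = 0
    · simp [hy] at h0 hj
      exact hj h0
    · refine hγ2 j ?_
      rw [div_eq_iff hy]
      linear_combination -h0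
  have hxy := h.ne
  have key := fun z => h.exists_mult hd hγ ht hr z
  have hsing : ∀ j s, eval (p j) (lin (Pi.single s 1)) = p j s := fun j s => by
    simp [eval_lin, Pi.single_apply]
  -- multiplication of `x0`, `y0` and of the elements of `e2`
  have hW : ∀ s, (s = x0 ∨ e2 s ≠ 0) → ∃ u v : ℂ, (2 ≤ e2 y0 → v = 0) ∧
      ∀ j, p j x0 * p j s = (p j x0 + γ * p j y0) * (u * p j x0 + v * p j y0) := by
    intro s hs
    obtain ⟨z', hz'⟩ := key (Pi.single s 1)
    obtain ⟨q1, q2⟩ := h.mult_coeffs hd hγ hz'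
    have hz : z' = Pi.single x0 (z' x0) + Pi.single y0 (z' y0) := by
      ext i
      by_cases h1 : i = x0
      · subst h1; simp [hxy]
      by_cases h2 : i = y0
      · subst h2; simp [h1]
      simp only [Pi.add_apply, Pi.single_apply, h1, h2, if_false, add_zero]
      by_cases h3 : e1 i = 0
      · exact q2 i ((hall i).resolve_left (not_not.2 h3)) (fun hh => absurd hh h2)
      · rw [q1 i h1 h3, Pi.single_apply, if_neg]
        rintro rfl
        rcases hs with hs | hs
        · exact h1 hs
        · exact (h.disj i).elim h3 hs
    refine ⟨z' x0, z' y0, fun h2 => q2 y0 h.pos2 (fun _ => h2), fun j => ?_⟩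
    have h4 := hz' j
    rw [hsing, hz] at h4
    rw [h4]
    simp [eval_lin, add_mul, Finset.sum_add_distrib, Pi.single_apply, hxy, hxy.symm]
  obtain ⟨x1, hx1, hx1'⟩ : ∃ x1, x1 ≠ x0 ∧ e1 x1 ≠ 0 := by
    by_contra! hcon
    have h1 := h.deg1
    rw [Finsupp.degree_eq_sum, Finset.sum_eq_single x0 (fun i _ hi => hcon i hi) (by simp)] at h1
    omega
  obtain ⟨κ, κ', hκ, hX1⟩ : ∃ u v : ℂ, (2 ≤ e2 y0 → v = 0) ∧
      ∀ j, p j x0 * p j x1 = (p j x0 + γ * p j y0) * (p j x1 + u * p j x0 + v * p j y0) := by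
    obtain ⟨z', hz'⟩ := key (Pi.single x1 1)
    obtain ⟨q1, q2⟩ := h.mult_coeffs hd hγ hz'
    have hx1y : x1 ≠ y0 := by
      rintro rfl
      exact hx1' h.x0y0.1
    have hz : z' = Pi.single x1 1 + Pi.single x0 (z' x0) + Pi.single y0 (z' y0) := by
      ext i
      by_cases h1 : i = x0
      · subst h1; simp [hxy, hx1.symm]
      by_cases h2 : i = y0
      · subst h2; simp [h1, hx1y.symm]
      simp only [Pi.add_apply, Pi.single_apply, h1, h2, if_false, add_zero]
      by_cases h3 : e1 i = 0
      · rw [q2 i ((hall i).resolve_left (not_not.2 h3)) (fun hh => absurd hh h2), if_neg]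
        rintro rfl
        exact hx1' h3
      · rw [q1 i h1 h3, Pi.single_apply]
    refine ⟨z' x0, z' y0, fun h2 => q2 y0 h.pos2 (fun _ => h2), fun j => ?_⟩
    have h4 := hz' j
    rw [hsing, hz] at h4
    rw [h4]
    simp [eval_lin, add_mul, Finset.sum_add_distrib, Pi.single_apply, hxy, hxy.symm]
  obtain ⟨a, b, hb, hX0⟩ := hW x0 (Or.inl rfl)
  by_contra! hcon
  obtain ⟨hc1, hc2⟩ := hcon
  by_cases h2 : 2 ≤ e2 y0
  · obtain rfl := hb h2
    obtain rfl := hκ h2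
    have ha : a - 1 = 0 := by
      refine h.no_rel hx1 hx1' (a - 1) (-κ) 0 fun j hj => ?_
      have hτ := ht j hj
      have e1 := hX0 j
      have e2 := hX1 j
      by_cases hξ : p j x0 = 0
      · rw [hξ] at e2 hτ ⊢
        have : p j x1 = 0 := by
          have e3 : (0 + γ * p j y0) * p j x1 = 0 := by linear_combination -e2
          exact (mul_eq_zero.1 e3).resolve_left hτ
        rw [this]; ring
      · have e3 : p j x0 = a * (p j x0 + γ * p j y0) := by
          apply mul_left_cancel₀ hξ
          linear_combination e1
        apply mul_left_cancel₀ hτ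
        linear_combination e2 - p j x1 * e3
    have e1 := hX0 j₀
    have : γ * (p j₀ x0 * p j₀ y0) = 0 := by
      linear_combination -e1 - (p j₀ x0 + γ * p j₀ y0) * p j₀ x0 * ha
    exact (mul_ne_zero hγ (mul_ne_zero hc1 hc2)) this
  · have hy01 : e2 y0 = 1 := by have := h.pos2; omega
    obtain ⟨y1, hy1, hy1'⟩ : ∃ y1, y1 ≠ y0 ∧ e2 y1 ≠ 0 := by
      by_contra! hcon
      have h1 := h.deg2
      rw [Finsupp.degree_eq_sum, Finset.sum_eq_single y0 (fun i _ hi => hcon i hi) (by simp)] at h1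
      omega
    obtain ⟨u, v, -, hY0⟩ := hW y0 (Or.inr h.pos2)
    obtain ⟨s, t, -, hY1⟩ := hW y1 (Or.inr hy1')
    have hD : ∀ j, (p j x0 ≠ 0 ∨ p j y0 ≠ 0) → ∃ D : ℂ, p j x0 = D * (p j x0 + γ * p j y0) ∧
        D * p j x0 = a * p j x0 + b * p j y0 ∧ D * p j y0 = u * p j x0 + v * p j y0 ∧
        D * p j x1 = p j x1 + κ * p j x0 + κ' * p j y0 ∧ D * p j y1 = s * p j x0 + t * p j y0 ∧
        D ^ 2 - (a + v) * D + (a * v - b * u) = 0 := by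
      intro j hj
      have hτ := ht j hj
      obtain ⟨D, hDd⟩ : ∃ D : ℂ, p j x0 = D * (p j x0 + γ * p j y0) :=
        ⟨p j x0 / (p j x0 + γ * p j y0), by field_simp⟩
      have g1 : D * p j x0 = a * p j x0 + b * p j y0 := by
        apply mul_left_cancel₀ hτ
        linear_combination hX0 j - p j x0 * hDd
      have g2 : D * p j y0 = u * p j x0 + v * p j y0 := by
        apply mul_left_cancel₀ hτ
        linear_combination hY0 j - p j y0 * hDd
      have g3 : D * p j x1 = p j x1 + κ * p j x0 + κ' * p j y0 := by
        apply mul_left_cancel₀ hτ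
        linear_combination hX1 j - p j x1 * hDd
      have g4 : D * p j y1 = s * p j x0 + t * p j y0 := by
        apply mul_left_cancel₀ hτ
        linear_combination hY1 j - p j y1 * hDd
      refine ⟨D, hDd, g1, g2, g3, g4, ?_⟩
      have k1 : (D ^ 2 - (a + v) * D + (a * v - b * u)) * p j x0 = 0 := by
        linear_combination (D - v) * g1 + b * g2
      have k2 : (D ^ 2 - (a + v) * D + (a * v - b * u)) * p j y0 = 0 := by
        linear_combination (D - a) * g2 + u * g1
      rcases hj with hj | hj
      · exact (mul_eq_zero.1 k1).resolve_right hj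
      · exact (mul_eq_zero.1 k2).resolve_right hj
    have hq1 : 1 - (a + v) + (a * v - b * u) = 0 := by
      refine h.no_rel hx1 hx1' _ ((1 - a - v) * κ + κ * a + κ' * u)
        ((1 - a - v) * κ' + κ * b + κ' * v) fun j hj => ?_
      obtain ⟨D, -, g1, g2, g3, -, gq⟩ := hD j hj
      linear_combination p j x1 * gq - (D + 1 - a - v) * g3 - κ * g1 - κ' * g2
    have hq0 : a * v - b * u = 0 := by
      refine h.swap.no_rel hy1 hy1' _ ((- a - v) * t + s * b + t * v)
        ((- a - v) * s + s * a + t * u) fun j hj => ?_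
      obtain ⟨D, -, g1, g2, -, g4, gq⟩ := hD j hj.symm
      linear_combination p j y1 * gq - (D - a - v) * g4 - s * g1 - t * g2
    obtain ⟨D, g0, -, -, -, -, gq⟩ := hD j₀ (Or.inl hc1)
    have hDD : D * (D - 1) = 0 := by
      linear_combination gq - D * hq1 + (D - 1) * hq0
    rcases mul_eq_zero.1 hDD with h0 | h1
    · rw [h0, zero_mul] at g0
      exact hc1 g0
    · have : γ * p j₀ y0 = 0 := by
        linear_combination -g0 + (-(p j₀ x0 + γ * p j₀ y0)) * h1
      exact (mul_ne_zero hγ hc2) this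

end Ap

lemma pairing_of_decomp {σ : Type*} [Fintype σ] [DecidableEq σ] {d r : ℕ} {e1 e2 : σ →₀ ℕ}
    (hne : e1 ≠ e2) {c : Fin r → ℂ} {p : Fin r → σ → ℂ}
    (hF : (monomial e1 1 + monomial e2 1 : MvPolynomial σ ℂ) = ∑ j, c j • lin (p j) ^ d)
    (G : MvPolynomial σ ℂ) (hG : G.IsHomogeneous d) :
    ∑ j, c j * eval (p j) G = coeff e1 G * (Nat.multinomial Finset.univ e1 : ℂ)⁻¹ +
      coeff e2 G * (Nat.multinomial Finset.univ e2 : ℂ)⁻¹ := by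
  have hmul : ∀ e : σ →₀ ℕ, (Nat.multinomial Finset.univ e : ℂ) ≠ 0 := fun e =>
    Nat.cast_ne_zero.2 (Nat.multinomial_pos _ _).ne'
  have h1 : ∀ e ∈ G.support, ∑ j, c j * ∏ i, p j i ^ e i =
      ((if e1 = e then 1 else 0) + (if e2 = e then 1 else 0)) *
        (Nat.multinomial Finset.univ e : ℂ)⁻¹ := by
    intro e he
    have hdeg : e.degree = d := by
      by_contra hcon
      exact mem_support_iff.1 he (hG.coeff_eq_zero hcon)
    have h2 := congrArg (coeff e) hF
    rw [coeff_add, coeff_monomial, coeff_monomial, coeff_sum] at h2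
    rw [h2, Finset.sum_mul]
    refine Finset.sum_congr rfl fun j _ => ?_
    rw [coeff_smul, coeff_lin_pow _ _ _ hdeg, smul_eq_mul]
    field_simp [hmul e]
  have h3 : ∑ j, c j * eval (p j) G = ∑ e ∈ G.support, coeff e G *
      (((if e1 = e then 1 else 0) + (if e2 = e then 1 else 0)) *
        (Nat.multinomial Finset.univ e : ℂ)⁻¹) := by
    simp only [eval_eq', Finset.mul_sum]
    rw [Finset.sum_comm]
    refine Finset.sum_congr rfl fun e he => ?_
    rw [← h1 e he, Finset.mul_sum]
    refine Finset.sum_congr rfl fun j _ => ?_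
    ring
  rw [h3]
  simp only [add_mul, mul_add, Finset.sum_add_distrib, ite_mul, one_mul, zero_mul, mul_ite,
    mul_zero, Finset.sum_ite_eq, mem_support_iff]
  congr 1 <;> (split_ifs with h4 <;> simp_all)

/-- for `F = x₀x₁^{a₁}⋯xₙ^{aₙ} + y₀^{b₀}⋯yₘ^{bₘ}` of degree `d ≥ 3`
(with `b₀` minimal), the Waring locus of `F` is contained in `V(X₀Y₀)`: every linear
form appearing in a minimal Waring decomposition of `F` has zero coefficient on `x₀`
or on `y₀`. -/
theorem waring_locus_sum_of_two_monomials_subset (n m : ℕ)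
    (a : Fin (n + 1) → ℕ) (b : Fin (m + 1) → ℕ)
    (ha0 : a 0 = 1) (ha : ∀ i, 1 ≤ a i) (hb : ∀ j, 1 ≤ b j) (hbmin : ∀ j, b 0 ≤ b j)
    (d : ℕ) (hda : ∑ i, a i = d) (hdb : ∑ j, b j = d) (hd3 : 3 ≤ d) :
    ∀ L : (Fin (n + 1) ⊕ Fin (m + 1)) → ℂ, L ≠ 0 →
      InWaringLocus d
          ((∏ i, X (Sum.inl i) ^ a i) + ∏ j, X (Sum.inr j) ^ b j :
            MvPolynomial (Fin (n + 1) ⊕ Fin (m + 1)) ℂ) L →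
        L (Sum.inl 0) = 0 ∨ L (Sum.inr 0) = 0 := by
  rintro L - ⟨c, p, j₀, rfl, hF⟩
  have hrank := waringRank_le n m a b (fun i => by rw [ha0]; exact ha i) hbmin d hda hdb (by omega)
  generalize waringRank d
          ((∏ i, X (Sum.inl i) ^ a i) + ∏ j, X (Sum.inr j) ^ b j :
            MvPolynomial (Fin (n + 1) ⊕ Fin (m + 1)) ℂ) = r at c p j₀ hF hrank
  let e1 : (Fin (n + 1) ⊕ Fin (m + 1)) →₀ ℕ := Finsupp.equivFunOnFinite.symm (Sum.elim a 0)
  let e2 : (Fin (n + 1) ⊕ Fin (m + 1)) →₀ ℕ := Finsupp.equivFunOnFinite.symm (Sum.elim 0 b)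
  have hb0 := hb 0
  have hne : e1 ≠ e2 := fun hh => by
    have := DFunLike.congr_fun hh (Sum.inl 0)
    simp [e1, e2, ha0] at this
  have hF' : (monomial e1 1 + monomial e2 1 : MvPolynomial (Fin (n + 1) ⊕ Fin (m + 1)) ℂ) =
      ∑ j, c j • lin (p j) ^ d := by
    rw [← hF, monomial_eq, monomial_eq, Finsupp.prod_fintype _ _ (by simp),
      Finsupp.prod_fintype _ _ (by simp)]
    simp [e1, e2]
  have hmul : ∀ e : (Fin (n + 1) ⊕ Fin (m + 1)) →₀ ℕ,
      (Nat.multinomial Finset.univ e : ℂ)⁻¹ ≠ 0 := fun e =>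
    inv_ne_zero (Nat.cast_ne_zero.2 (Nat.multinomial_pos _ _).ne')
  have hAp : Ap d r e1 e2 (Sum.inl 0) (Sum.inr 0) c p (Nat.multinomial Finset.univ e1 : ℂ)⁻¹
      (Nat.multinomial Finset.univ e2 : ℂ)⁻¹ :=
    { deg1 := by simp [e1, Finsupp.degree_eq_sum, hda]
      deg2 := by simp [e2, Finsupp.degree_eq_sum, hdb]
      disj := by rintro (i | i) <;> simp [e1, e2]
      pos1 := by simp [e1, ha0]
      pos2 := by simp [e2]; omega
      hl1 := hmul _
      hl2 := hmul _
      pairing := pairing_of_decomp hne hF' }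
  have hcard : ∀ e : (Fin (n + 1) ⊕ Fin (m + 1)) →₀ ℕ,
      (Finset.Iic e).card = ∏ i, (e i + 1) := fun e => by
    rw [Finsupp.card_Iic]
    simp only [Nat.card_Iic]
    exact Finset.prod_subset (Finset.subset_univ _) (fun i _ hi => by simpa using hi)
  refine hAp.final hd3 (by simp [e1, ha0]) ?_ ?_ j₀
  · rintro (i | i)
    · left; simp [e1]; have := ha i; omega
    · right; simp [e2]; have := hb i; omega
  · rw [hcard, hcard]
    convert hrank using 2
    · simp [Fintype.prod_sum_type, Fin.prod_univ_succ, e1, Finsupp.erase_apply]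
    · simp [Fintype.prod_sum_type, Fin.prod_univ_succ, e2, Finsupp.erase_apply]

end
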